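/- Let G be a nonempty position with c(G) ≥ 2. Then v(G) = c(G), and the following move is optimal: open a 3-chain if G has a 3-chain and at least one other chain; otherwise, open a loop of minimal length if G has a loop; otherwise, open a chain of minimal length. -/

import Mathlib

namespace DotsAndBoxes

/-- A component of a Dots & Boxes endgame position: an `n`-chain or an `n`-loop. -/
inductive Component : Type where
  | chain (n : ℕ)
  | loop (n : ℕ)
deriving DecidableEq

namespace Component

/-- The number of boxes in a component. -/
def size : Component → ℕ
  | chain n => n
  | loop n => n

def isChain : Component → Bool
  | chain _ => true
  | loop _ => false

def isLoop : Component → Bool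
  | chain _ => false
  | loop _ => true

/-- A chain must have length at least 3; a loop must have even length at least 4. -/
def Valid : Component → Prop
  | chain n => 3 ≤ n
  | loop n => 4 ≤ n ∧ Even n

end Component

/-- A position is a finite multiset of components. -/
abbrev Position := Multiset Component

def Position.Valid (G : Position) : Prop := ∀ C ∈ G, C.Valid

/-- The number of unclaimed boxes in a position. -/
def size (G : Position) : ℕ := (G.map Component.size).sum

/-- The number of chains of a position. -/
def numChains (G : Position) : ℕ := Multiset.card (G.filter fun C => C.isChain = true)

/-- The number of loops of a position. -/
def numLoops (G : Position) : ℕ := Multiset.card (G.filter fun C => C.isLoop = true)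

/-- θ(G), the number of 3-chains. -/
def theta (G : Position) : ℕ := G.count (Component.chain 3)

/-- f(G), the number of 4-loops. -/
def numF (G : Position) : ℕ := G.count (Component.loop 4)

/-- s(G), the number of 6-loops. -/
def numS (G : Position) : ℕ := G.count (Component.loop 6)

open Classical in
/-- The terminal bonus tb(G). -/
noncomputable def tb (G : Position) : ℤ :=
  if G = 0 then 0
  else if ∀ C ∈ G, C.isLoop = true then 8
  else if (∃ C ∈ G, C.isLoop = true) ∧ Component.chain 3 ∈ G ∧
      (∀ C ∈ G, C.isChain = true → C = Component.chain 3) then 6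
  else 4

/-- The controlled value c(G). -/
noncomputable def cval (G : Position) : ℤ :=
  (size G : ℤ) - 4 * (numChains G : ℤ) - 8 * (numLoops G : ℤ) + tb G

/-- The score v(G;C) of opening component `C`, given that the remainder of the
position has value `w`. -/
def openVal (C : Component) (w : ℤ) : ℤ :=
  match C with
  | Component.chain n => ((n : ℤ) - 2) + |w - 2|
  | Component.loop n => ((n : ℤ) - 4) + |w - 4|

/-- Auxiliary recursion (on the number of components) for the value `v`. -/
noncomputable def valueAux : ℕ → Position → ℤ
  | 0, _ => 0
  | n + 1, G =>
    if G = 0 then 0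
    else sInf { x : ℤ | ∃ C ∈ G, x = openVal C (valueAux n (G.erase C)) }

/-- The value v(G): v(∅) = 0, and v(G) = min over components C of G of v(G;C). -/
noncomputable def value (G : Position) : ℤ := valueAux (Multiset.card G) G

/-- v(G;C), the value of G given that the opener has just opened C. -/
noncomputable def valueOpen (G : Position) (C : Component) : ℤ :=
  openVal C (value (G.erase C))

/-- Opening a component C of G is optimal if C ∈ G and v(G;C) = v(G). -/
def Optimal (G : Position) (C : Component) : Prop :=
  C ∈ G ∧ valueOpen G C = value G


/-- Contribution of a component to the fully controlled value. -/
def wt : Component → ℤ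
  | Component.chain n => (n : ℤ) - 4
  | Component.loop n => (n : ℤ) - 8

def fc (G : Position) : ℤ := (G.map wt).sum

lemma fc_cons (C : Component) (G : Position) : fc (C ::ₘ G) = wt C + fc G := by
  simp [fc]

lemma fc_zero : fc 0 = 0 := by simp [fc]

lemma numChains_chain (n : ℕ) (G : Position) :
    numChains (Component.chain n ::ₘ G) = numChains G + 1 := by
  unfold numChains
  rw [Multiset.filter_cons_of_pos _ (by simp [Component.isChain])]
  simp

lemma numChains_loop (n : ℕ) (G : Position) :
    numChains (Component.loop n ::ₘ G) = numChains G := by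
  unfold numChains
  rw [Multiset.filter_cons_of_neg _ (by simp [Component.isChain])]

lemma numLoops_loop (n : ℕ) (G : Position) :
    numLoops (Component.loop n ::ₘ G) = numLoops G + 1 := by
  unfold numLoops
  rw [Multiset.filter_cons_of_pos _ (by simp [Component.isLoop])]
  simp

lemma numLoops_chain (n : ℕ) (G : Position) :
    numLoops (Component.chain n ::ₘ G) = numLoops G := by
  unfold numLoops
  rw [Multiset.filter_cons_of_neg _ (by simp [Component.isLoop])]

lemma size_cons (C : Component) (G : Position) : size (C ::ₘ G) = C.size + size G := by
  simp [size]

lemma cval_eq (G : Position) : cval G = fc G + tb G := by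
  have h : (size G : ℤ) - 4 * (numChains G : ℤ) - 8 * (numLoops G : ℤ) = fc G := by
    induction G using Multiset.induction with
    | empty => simp [fc, size, numChains, numLoops]
    | cons C G ih =>
      rw [fc_cons, ← ih]
      rcases C with n | n
      · rw [size_cons, numChains_chain, numLoops_chain]
        simp only [Component.size, wt]
        push_cast
        ring
      · rw [size_cons, numChains_loop, numLoops_loop]
        simp only [Component.size, wt]
        push_cast
        ring
  simp only [cval, h]

lemma tb_zero : tb 0 = 0 := by simp [tb]

lemma cval_zero : cval 0 = 0 := by simp [cval_eq, fc_zero, tb_zero]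

lemma tb_loops (G : Position) (h0 : G ≠ 0) (h : ∀ C ∈ G, C.isLoop = true) : tb G = 8 := by
  unfold tb
  rw [if_neg h0, if_pos h]

lemma tb_six (G : Position) (h0 : ∃ C ∈ G, C.isLoop = true) (h : Component.chain 3 ∈ G)
    (h' : ∀ n, Component.chain n ∈ G → n = 3) : tb G = 6 := by
  unfold tb
  rw [if_neg, if_neg, if_pos]
  · refine ⟨h0, h, ?_⟩
    rintro (n | n) hC hc
    · rw [h' n hC]
    · simp [Component.isChain] at hc
  · intro hh
    simpa [Component.isLoop] using hh _ h
  · rintro rfl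
    simp at h

lemma tb_four (G : Position) (n : ℕ) (h : Component.chain n ∈ G)
    (h' : n ≠ 3 ∨ ∀ C ∈ G, C.isLoop = false) : tb G = 4 := by
  unfold tb
  rw [if_neg, if_neg, if_neg]
  · rintro ⟨⟨C, hC, hl⟩, h3, hall⟩
    rcases h' with h' | h'
    · have := hall _ h rfl
      simp at this
      exact h' this
    · rw [h' C hC] at hl
      simp at hl
  · intro hh
    simpa [Component.isLoop] using hh _ h
  · rintro rfl
    simp at h

/-- Every nonempty position falls into exactly one of the three classes. -/
lemma tb_cases (G : Position) (h0 : G ≠ 0) :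
    ((∀ C ∈ G, C.isLoop = true) ∧ tb G = 8) ∨
    ((∃ C ∈ G, C.isLoop = true) ∧ Component.chain 3 ∈ G ∧
      (∀ n, Component.chain n ∈ G → n = 3) ∧ tb G = 6) ∨
    ((∃ n, Component.chain n ∈ G ∧ (n ≠ 3 ∨ ∀ C ∈ G, C.isLoop = false)) ∧ tb G = 4) := by
  by_cases h1 : ∀ C ∈ G, C.isLoop = true
  · exact Or.inl ⟨h1, tb_loops G h0 h1⟩
  right
  push Not at h1
  obtain ⟨C, hC, hl⟩ := h1
  rcases C with n | n
  swap
  · simp [Component.isLoop] at hl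
  by_cases h2 : ∃ m, Component.chain m ∈ G ∧ m ≠ 3
  · obtain ⟨m, hm, h3⟩ := h2
    exact Or.inr ⟨⟨m, hm, Or.inl h3⟩, tb_four G m hm (Or.inl h3)⟩
  push Not at h2
  have hn := h2 n hC
  subst hn
  by_cases h3 : ∃ C ∈ G, C.isLoop = true
  · exact Or.inl ⟨h3, hC, h2, tb_six G h3 hC h2⟩
  · have h4 : ∀ C ∈ G, C.isLoop = false := by
      intro C hC'
      by_contra hh
      exact h3 ⟨C, hC', by simpa using hh⟩
    exact Or.inr ⟨⟨3, hC, Or.inr h4⟩, tb_four G 3 hC (Or.inr h4)⟩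

lemma tb_ge (G : Position) (h0 : G ≠ 0) : 4 ≤ tb G := by
  rcases tb_cases G h0 with h | h | h
  · rw [h.2]; norm_num
  · rw [h.2.2.2]; norm_num
  · rw [h.2]

lemma value_zero : value 0 = 0 := by simp [value, valueAux]

lemma value_set (G : Position) (h0 : G ≠ 0) :
    value G = sInf {x : ℤ | ∃ C ∈ G, x = valueOpen G C} := by
  obtain ⟨n, hn⟩ : ∃ n, Multiset.card G = n + 1 :=
    Nat.exists_eq_succ_of_ne_zero (by simpa using h0)
  unfold value
  rw [hn, valueAux, if_neg h0]
  congr 1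
  ext x
  simp only [Set.mem_ofPred_eq]
  refine exists_congr fun C => and_congr_right fun hC => ?_
  unfold valueOpen value
  rw [Multiset.card_erase_of_mem hC, hn]
  rfl

lemma value_set_finite (G : Position) : {x : ℤ | ∃ C ∈ G, x = valueOpen G C}.Finite := by
  have : {x : ℤ | ∃ C ∈ G, x = valueOpen G C} = Set.image (valueOpen G) (G.toFinset : Set Component) := by
    ext x
    simp [eq_comm]
  rw [this]
  exact (Finset.finite_toSet _).image _

lemma value_le (G : Position) (C : Component) (hC : C ∈ G) : value G ≤ valueOpen G C := by
  have h0 : G ≠ 0 := by rintro rfl; simp at hC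
  rw [value_set G h0]
  exact csInf_le (value_set_finite G).bddBelow ⟨C, hC, rfl⟩

lemma value_attained (G : Position) (h0 : G ≠ 0) : ∃ C ∈ G, value G = valueOpen G C := by
  obtain ⟨C, hC⟩ := Multiset.exists_mem_of_ne_zero h0
  have := Int.csInf_mem (s := {x : ℤ | ∃ C ∈ G, x = valueOpen G C})
    ⟨_, C, hC, rfl⟩ (value_set_finite G).bddBelow
  rw [← value_set G h0] at this
  exact this

lemma valueOpen_cons (C : Component) (G : Position) :
    valueOpen (C ::ₘ G) C = openVal C (value G) := by
  simp [valueOpen]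

lemma value_singleton (C : Component) : value (C ::ₘ 0) = openVal C 0 := by
  obtain ⟨D, hD, h⟩ := value_attained (C ::ₘ 0) (by simp)
  have : D = C := by simpa using hD
  subst this
  rw [h, valueOpen_cons, value_zero]

lemma valid_tail {C : Component} {G : Position} (h : Position.Valid (C ::ₘ G)) :
    Position.Valid G := fun D hD => h D (Multiset.mem_cons_of_mem hD)

lemma value_nonneg (G : Position) (hG : G.Valid) : 0 ≤ value G := by
  by_cases h0 : G = 0
  · rw [h0, value_zero]
  obtain ⟨C, hC, h⟩ := value_attained G h0
  rw [h]
  have hv := hG C hC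
  rcases C with n | n
  · simp only [Component.Valid] at hv
    simp only [valueOpen, openVal]
    have := abs_nonneg (value (G.erase (Component.chain n)) - 2)
    omega
  · simp only [Component.Valid] at hv
    simp only [valueOpen, openVal]
    have := abs_nonneg (value (G.erase (Component.loop n)) - 4)
    omega

lemma threes (G : Position) (h : ∀ C ∈ G, C = Component.chain 3) :
    value G ≤ 3 ∧ fc G = -(Multiset.card G : ℤ) := by
  induction G using Multiset.induction with
  | empty => simp [value_zero, fc_zero]
  | cons C G ih =>
    have hC := h C (Multiset.mem_cons_self C G)
    subst hC
    have hG : ∀ C ∈ G, C = Component.chain 3 := fun D hD => h D (Multiset.mem_cons_of_mem hD)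
    obtain ⟨i1, i2⟩ := ih hG
    have hnn := value_nonneg G (by intro D hD; rw [hG D hD]; simp [Component.Valid])
    constructor
    · refine (value_le _ _ (Multiset.mem_cons_self _ G)).trans ?_
      rw [valueOpen_cons]
      simp only [openVal]
      have : |value G - 2| ≤ 2 := abs_le.2 ⟨by omega, by omega⟩
      push_cast
      omega
    · rw [fc_cons, i2]
      simp only [wt, Multiset.card_cons]
      push_cast
      ring

/-- The controller never does worse than the controlled value. -/
lemma cval_le_open (C : Component) (G : Position) (hG : Position.Valid (C ::ₘ G))
    (ih : cval G ≤ value G) : cval (C ::ₘ G) ≤ openVal C (value G) := by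
  by_cases h0 : G = 0
  · subst h0
    rcases C with n | n
    · rw [cval_eq, fc_cons, fc_zero, tb_four _ n (by simp) (Or.inr (by simp [Component.isLoop])),
        value_zero]
      simp [wt, openVal]
    · rw [cval_eq, fc_cons, fc_zero, tb_loops _ (by simp) (by simp [Component.isLoop]),
        value_zero]
      simp [wt, openVal]
  rw [cval_eq] at ih ⊢
  rw [fc_cons]
  rcases C with n | n
  · have htb : tb (Component.chain n ::ₘ G) ≤ tb G := by
      rcases tb_cases (Component.chain n ::ₘ G) (by simp) with h | h | h
      · have := h.1 (Component.chain n) (by simp)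
        simp [Component.isLoop] at this
      · obtain ⟨⟨D, hD, hl⟩, h3, hall, ht⟩ := h
        rw [ht]
        have hDG : D ∈ G := by
          rcases Multiset.mem_cons.1 hD with rfl | hD
          · simp [Component.isLoop] at hl
          · exact hD
        rcases tb_cases G h0 with h | h | h
        · rw [h.2]; norm_num
        · rw [h.2.2.2]
        · obtain ⟨⟨m, hm, h⟩, -⟩ := h
          exfalso
          rcases h with h | h
          · exact h (hall m (by simp [hm]))
          · rw [h D hDG] at hl
            simp at hl
      · rw [h.2]
        exact tb_ge G h0
    simp only [wt, openVal]
    have := le_abs_self (value G - 2)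
    omega
  · simp only [wt, openVal]
    have hab := le_abs_self (value G - 4)
    rcases tb_cases (Component.loop n ::ₘ G) (by simp) with h | h | h
    · have := tb_loops G h0 (fun D hD => h.1 D (by simp [hD]))
      rw [h.2]
      omega
    · obtain ⟨-, h3, hall, ht⟩ := h
      rw [ht]
      by_cases hl : ∃ D ∈ G, D.isLoop = true
      · have : tb G = 6 := tb_six G hl (by simpa using h3)
          (fun m hm => hall m (by simp [hm]))
        omega
      · have hth := threes G (by
          rintro (m | m) hm
          · rw [hall m (by simp [hm])]
          · exact absurd ⟨_, hm, rfl⟩ hl)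
        have hcard : 0 < Multiset.card G := Multiset.card_pos.2 h0
        have := neg_le_abs (value G - 4)
        omega
    · have := tb_ge G h0
      rw [h.2]
      omega

lemma cval_le_value (G : Position) (hG : G.Valid) : cval G ≤ value G := by
  induction hk : Multiset.card G generalizing G with
  | zero =>
    have : G = 0 := by simpa using hk
    rw [this, cval_zero, value_zero]
  | succ k ih =>
    have h0 : G ≠ 0 := by rintro rfl; simp at hk
    obtain ⟨C, hC, h⟩ := value_attained G h0
    obtain ⟨R, rfl⟩ := Multiset.exists_cons_of_mem hC
    rw [h, valueOpen_cons]
    exact cval_le_open C R hG (ih R (valid_tail hG) (by simpa using hk))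

lemma fc_nonneg (G : Position) (hc : ∀ m, Component.chain m ∈ G → 4 ≤ m)
    (hl : ∀ m, Component.loop m ∈ G → 8 ≤ m) : 0 ≤ fc G := by
  apply Multiset.sum_nonneg
  intro x hx
  obtain ⟨C, hC, rfl⟩ := Multiset.mem_map.1 hx
  rcases C with m | m
  · have := hc m hC
    simp only [wt]; omega
  · have := hl m hC
    simp only [wt]; omega

lemma numChains_pos (G : Position) : 0 < numChains G ↔ ∃ m, Component.chain m ∈ G := by
  unfold numChains
  rw [Multiset.card_pos_iff_exists_mem]
  constructor
  · rintro ⟨C, hC⟩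
    rw [Multiset.mem_filter] at hC
    rcases C with m | m
    · exact ⟨m, hC.1⟩
    · simp [Component.isChain] at hC
  · rintro ⟨m, hm⟩
    exact ⟨_, Multiset.mem_filter.2 ⟨hm, rfl⟩⟩

/-- Induction hypothesis for the positions that remain after a move. -/
def Good (G : Position) : Prop := G ≠ 0 → 2 ≤ cval G → value G = cval G

lemma moveA (G : Position) (ih : Good G)
    (hc : 2 ≤ cval (Component.chain 3 ::ₘ G)) (hn : 0 < numChains G) :
    openVal (Component.chain 3) (value G) = cval (Component.chain 3 ::ₘ G) := by
  obtain ⟨m, hm⟩ := (numChains_pos G).1 hn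
  have h0 : G ≠ 0 := by rintro rfl; simp at hm
  have htb : tb (Component.chain 3 ::ₘ G) = tb G := by
    rcases tb_cases G h0 with h | h | h
    · have := h.1 _ hm
      simp [Component.isLoop] at this
    · obtain ⟨⟨D, hD, hl⟩, h3, hall, ht⟩ := h
      rw [ht]
      refine tb_six _ ⟨D, by simp [hD], hl⟩ (by simp) ?_
      intro k hk
      rcases Multiset.mem_cons.1 hk with h | h
      · simpa using h
      · exact hall k h
    · obtain ⟨⟨k, hk, h⟩, ht⟩ := h
      rw [ht]
      refine tb_four _ k (by simp [hk]) ?_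
      rcases h with h | h
      · exact Or.inl h
      · right
        intro D hD
        rcases Multiset.mem_cons.1 hD with rfl | hD
        · rfl
        · exact h D hD
  have e : cval (Component.chain 3 ::ₘ G) = cval G - 1 := by
    rw [cval_eq, cval_eq, fc_cons, htb]
    simp [wt]; ring
  rw [e] at hc ⊢
  rw [ih h0 (by omega)]
  simp only [openVal]
  rw [abs_of_nonneg (by omega)]
  push_cast
  ring

lemma moveB (n : ℕ) (G : Position) (hG : Position.Valid (Component.loop n ::ₘ G)) (ih : Good G)
    (hc : 2 ≤ cval (Component.loop n ::ₘ G))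
    (hn : ¬ (Component.chain 3 ∈ G ∧ 2 ≤ numChains G))
    (hmin : ∀ m, Component.loop m ∈ G → n ≤ m) :
    openVal (Component.loop n) (value G) = cval (Component.loop n ::ₘ G) := by
  by_cases h0 : G = 0
  · subst h0
    rw [cval_eq, fc_cons, fc_zero, tb_loops _ (by simp) (by simp [Component.isLoop]), value_zero]
    simp [wt, openVal]
  have hv : 4 ≤ n ∧ Even n := hG (Component.loop n) (by simp)
  have hGv : Position.Valid G := valid_tail hG
  -- it is enough to know the bonus is unchanged and a bound for long loops
  have key : tb (Component.loop n ::ₘ G) = tb G → (8 ≤ n → 4 ≤ cval G) →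
      openVal (Component.loop n) (value G) = cval (Component.loop n ::ₘ G) := by
    intro htb h8
    have e : cval (Component.loop n ::ₘ G) = cval G + n - 8 := by
      rw [cval_eq, cval_eq, fc_cons, htb]
      simp only [wt]; ring
    have h4 : 4 ≤ cval G := by
      by_cases h : 8 ≤ n
      · exact h8 h
      · have : n ≤ 6 := by
          obtain ⟨k, hk⟩ := hv.2
          omega
        omega
    rw [e, ih h0 (by omega)]
    simp only [openVal]
    rw [abs_of_nonneg (by omega)]
    ring
  rcases tb_cases G h0 with h | h | h
  · apply key
    · rw [h.2]
      apply tb_loops _ (by simp)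
      intro D hD
      rcases Multiset.mem_cons.1 hD with rfl | hD
      · rfl
      · exact h.1 D hD
    · intro h8
      rw [cval_eq, h.2]
      have := fc_nonneg G (fun m hm => by simpa [Component.isLoop] using h.1 _ hm)
        (fun m hm => h8.trans (hmin m hm))
      omega
  · obtain ⟨hl, h3, hall, ht⟩ := h
    apply key
    · rw [ht]
      refine tb_six _ ⟨Component.loop n, by simp, rfl⟩ (by simp [h3]) ?_
      intro k hk
      exact hall k (by simpa using hk)
    · intro h8
      rw [cval_eq, ht]
      obtain ⟨R, rfl⟩ := Multiset.exists_cons_of_mem h3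
      have hR : ¬ 0 < numChains R := by
        intro hp
        apply hn
        refine ⟨h3, ?_⟩
        rw [numChains_chain]; omega
      rw [numChains_pos] at hR
      have := fc_nonneg R (fun m hm => absurd ⟨m, hm⟩ hR)
        (fun m hm => h8.trans (hmin m (by simp [hm])))
      rw [fc_cons]
      simp only [wt]
      push_cast
      omega
  · obtain ⟨⟨k, hk, h⟩, ht⟩ := h
    by_cases h3 : Component.chain 3 ∈ G
    · -- the rest is a single three-chain
      obtain ⟨R, rfl⟩ := Multiset.exists_cons_of_mem h3
      have hR : ¬ 0 < numChains R := by
        intro hp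
        apply hn
        refine ⟨h3, ?_⟩
        rw [numChains_chain]; omega
      rw [numChains_pos] at hR
      have hk3 : k = 3 := by
        rcases Multiset.mem_cons.1 hk with h | h
        · simpa using h
        · exact absurd ⟨k, h⟩ hR
      have hl : ∀ C ∈ Component.chain 3 ::ₘ R, C.isLoop = false := by
        rcases h with h | h
        · exact absurd hk3 h
        · exact h
      have hR0 : R = 0 := by
        by_contra hne
        obtain ⟨D, hD⟩ := Multiset.exists_mem_of_ne_zero hne
        rcases D with m | m
        · exact hR ⟨m, hD⟩
        · have := hl _ (Multiset.mem_cons_of_mem hD)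
          simp [Component.isLoop] at this
      subst hR0
      rw [value_singleton, cval_eq, fc_cons, fc_cons, fc_zero,
        tb_six _ ⟨Component.loop n, by simp, rfl⟩ (by simp) (by simp)]
      simp [wt, openVal]
      ring
    · have hk3 : k ≠ 3 := by rintro rfl; exact h3 hk
      apply key
      · rw [ht]
        exact tb_four _ k (by simp [hk]) (Or.inl hk3)
      · intro h8
        rw [cval_eq, ht]
        have := fc_nonneg G (fun m hm => by
            have h1 : 3 ≤ m := hGv _ hm
            have h2 : m ≠ 3 := by rintro rfl; exact h3 hm
            omega)
          (fun m hm => h8.trans (hmin m hm))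
        omega

lemma moveC (n : ℕ) (G : Position) (hG : Position.Valid (Component.chain n ::ₘ G)) (ih : Good G)
    (hn : ¬ (Component.chain 3 ∈ Component.chain n ::ₘ G ∧
      2 ≤ numChains (Component.chain n ::ₘ G)))
    (hl : ∀ C ∈ Component.chain n ::ₘ G, C.isLoop = false) :
    openVal (Component.chain n) (value G) = cval (Component.chain n ::ₘ G) := by
  have ht := tb_four (Component.chain n ::ₘ G) n (by simp) (Or.inr hl)
  by_cases h0 : G = 0
  · subst h0
    rw [cval_eq, fc_cons, fc_zero, ht, value_zero]
    simp [wt, openVal]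
  obtain ⟨D, hD⟩ := Multiset.exists_mem_of_ne_zero h0
  rcases D with m | m
  swap
  · have := hl _ (Multiset.mem_cons_of_mem hD)
    simp [Component.isLoop] at this
  have h3 : Component.chain 3 ∉ Component.chain n ::ₘ G := by
    intro h3
    apply hn
    refine ⟨h3, ?_⟩
    have := (numChains_pos G).2 ⟨m, hD⟩
    rw [numChains_chain]; omega
  have htG := tb_four G m hD (Or.inr fun C hC => hl C (Multiset.mem_cons_of_mem hC))
  have hnn := fc_nonneg G (fun k hk => by
      have h1 : 3 ≤ k := hG _ (Multiset.mem_cons_of_mem hk)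
      have h2 : k ≠ 3 := by rintro rfl; exact h3 (Multiset.mem_cons_of_mem hk)
      omega)
    (fun k hk => by
      have := hl _ (Multiset.mem_cons_of_mem hk)
      simp [Component.isLoop] at this)
  have e : cval G = fc G + 4 := by rw [cval_eq, htG]
  rw [ih h0 (by omega), e, cval_eq, ht, fc_cons]
  simp only [openVal, wt]
  rw [abs_of_nonneg (by omega)]
  ring

/-- All three kinds of recommended moves achieve the controlled value, given the
induction hypothesis for the remaining positions. -/
lemma moves (G : Position) (hG : G.Valid) (hc : 2 ≤ cval G)
    (ih : ∀ C ∈ G, Good (G.erase C)) :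
    ((Component.chain 3 ∈ G ∧ 2 ≤ numChains G) →
      valueOpen G (Component.chain 3) = cval G) ∧
    (¬ (Component.chain 3 ∈ G ∧ 2 ≤ numChains G) →
      ∀ n : ℕ, Component.loop n ∈ G → (∀ m : ℕ, Component.loop m ∈ G → n ≤ m) →
        valueOpen G (Component.loop n) = cval G) ∧
    (¬ (Component.chain 3 ∈ G ∧ 2 ≤ numChains G) → (∀ C ∈ G, C.isLoop = false) →
      ∀ n : ℕ, Component.chain n ∈ G → valueOpen G (Component.chain n) = cval G) := by
  refine ⟨?_, ?_, ?_⟩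
  · rintro ⟨h3, hn⟩
    have ih' := ih _ h3
    obtain ⟨R, rfl⟩ := Multiset.exists_cons_of_mem h3
    rw [Multiset.erase_cons_head] at ih'
    rw [valueOpen_cons]
    rw [numChains_chain] at hn
    exact moveA R ih' hc (by omega)
  · intro hn n hm hmin
    have ih' := ih _ hm
    obtain ⟨R, rfl⟩ := Multiset.exists_cons_of_mem hm
    rw [Multiset.erase_cons_head] at ih'
    rw [valueOpen_cons]
    rw [numChains_loop] at hn
    exact moveB n R hG ih' hc (fun h => hn ⟨by simp [h.1], h.2⟩)
      (fun m hm => hmin m (by simp [hm]))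
  · intro hn hl n hm
    have ih' := ih _ hm
    obtain ⟨R, rfl⟩ := Multiset.exists_cons_of_mem hm
    rw [Multiset.erase_cons_head] at ih'
    rw [valueOpen_cons]
    exact moveC n R hG ih' hn hl

lemma value_of_moves (G : Position) (hG : G.Valid) (hne : G ≠ 0) (hc : 2 ≤ cval G)
    (ih : ∀ C ∈ G, Good (G.erase C)) : value G = cval G := by
  obtain ⟨hA, hB, hC⟩ := moves G hG hc ih
  refine le_antisymm ?_ (cval_le_value G hG)
  by_cases h : Component.chain 3 ∈ G ∧ 2 ≤ numChains G
  · rw [← hA h]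
    exact value_le G _ h.1
  by_cases hl : ∃ n, Component.loop n ∈ G
  · classical
    rw [← hB h (Nat.find hl) (Nat.find_spec hl) (fun m hm => Nat.find_min' hl hm)]
    exact value_le G _ (Nat.find_spec hl)
  · have hl' : ∀ C ∈ G, C.isLoop = false := by
      rintro (m | m) hm
      · rfl
      · exact absurd ⟨m, hm⟩ hl
    obtain ⟨D, hD⟩ := Multiset.exists_mem_of_ne_zero hne
    rcases D with m | m
    · rw [← hC h hl' m hD]
      exact value_le G _ hD
    · exact absurd ⟨m, hD⟩ hl

lemma good_of_valid (G : Position) (hG : G.Valid) : Good G := by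
  induction hk : Multiset.card G generalizing G with
  | zero => exact fun h0 => absurd (by simpa using hk) h0
  | succ k ih =>
    intro h0 hc
    refine value_of_moves G hG h0 hc fun C hC => ih _ ?_ ?_
    · exact fun D hD => hG D (Multiset.mem_of_mem_erase hD)
    · rw [Multiset.card_erase_of_mem hC, hk]; rfl

/-- Large controlled values: if c(G) ≥ 2 then v(G) = c(G), and the described move
is optimal: a 3-chain if G has one and at least one other chain; otherwise a loop of
minimal length if G has a loop; otherwise a chain of minimal length. -/
theorem large_controlled_values (G : Position) (hG : G.Valid) (hne : G ≠ 0)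
    (hc : 2 ≤ cval G) :
    value G = cval G ∧
    ((Component.chain 3 ∈ G ∧ 2 ≤ numChains G) → Optimal G (Component.chain 3)) ∧
    (¬ (Component.chain 3 ∈ G ∧ 2 ≤ numChains G) →
      ∀ n : ℕ, Component.loop n ∈ G → (∀ m : ℕ, Component.loop m ∈ G → n ≤ m) →
        Optimal G (Component.loop n)) ∧
    (¬ (Component.chain 3 ∈ G ∧ 2 ≤ numChains G) → (∀ C ∈ G, C.isLoop = false) →
      ∀ n : ℕ, Component.chain n ∈ G → (∀ m : ℕ, Component.chain m ∈ G → n ≤ m) →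
        Optimal G (Component.chain n)) := by
  have ih : ∀ C ∈ G, Good (G.erase C) := fun C _ =>
    good_of_valid _ fun D hD => hG D (Multiset.mem_of_mem_erase hD)
  have hv := good_of_valid G hG hne hc
  obtain ⟨hA, hB, hC⟩ := moves G hG hc ih
  refine ⟨hv, fun h => ⟨h.1, ?_⟩, fun h n hn hmin => ⟨hn, ?_⟩, fun h hl n hn _ => ⟨hn, ?_⟩⟩
  · rw [hv, hA h]
  · rw [hv, hB h n hn hmin]
  · rw [hv, hC h hl n hn]

end DotsAndBoxes
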